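/- arXiv:1201.0192 — 2 statements merged into one kernel-verified Lean document; each statement's English description precedes it below -/
import Mathlib

section
/- Let 𝕂 = ℝ or ℂ and let G₁, G₂ be (n+1)×(n+1) block matrices Gᵢ = [[Fᵢ, Xᵢ],[Yᵢᵀ, η]] with Fᵢ invertible n×n, Xᵢ, Yᵢ nonzero column vectors, the same scalar η, and Y₁ᵀF₁⁻¹X₁ = Y₂ᵀF₂⁻¹X₂ ≠ 0. Then there exists an invertible n×n matrix R such that G₂ = diag(F₂R⁻¹F₁⁻¹, 1) · G₁ · diag(R, 1). -/
open Matrix in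
theorem exists_unit_mul_eq {𝕂 : Type*} [RCLike 𝕂] {n : ℕ}
    (u v : Matrix (Fin n) (Fin 1) 𝕂) (hu : u ≠ 0) (hv : v ≠ 0) :
    ∃ A B : Matrix (Fin n) (Fin n) 𝕂, A * B = 1 ∧ B * A = 1 ∧ A * u = v := by
  have key : ∀ w : Matrix (Fin n) (Fin 1) 𝕂, w ≠ 0 → (fun i => w i 0) ≠ 0 := by
    intro w hw h
    apply hw
    ext i j
    rw [Subsingleton.elim j 0]
    exact congrFun h i
  obtain ⟨L, hL⟩ := SeparatingDual.exists_continuousLinearEquiv_apply_eq (R := 𝕂)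
    (key u hu) (key v hv)
  have h1 : LinearMap.toMatrix' L.toLinearEquiv.toLinearMap *
      LinearMap.toMatrix' L.symm.toLinearEquiv.toLinearMap = 1 := by
    rw [← LinearMap.toMatrix'_comp, ← LinearMap.toMatrix'_id]
    congr 1
    ext
    simp
  refine ⟨_, _, h1, mul_eq_one_comm.mp h1, ?_⟩
  ext i j
  rw [Subsingleton.elim j 0]
  have h2 := LinearMap.toMatrix'_mulVec L.toLinearEquiv.toLinearMap (fun i => u i 0)
  have h3 := congrFun h2 i
  have h4 := congrFun hL i
  exact h3.trans h4

open Matrix in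
theorem block_conjugation {𝕂 : Type*} [RCLike 𝕂] {n : ℕ} (hn : 1 < n)
    (F₁ F₂ : Matrix (Fin n) (Fin n) 𝕂) (X₁ X₂ Y₁ Y₂ : Matrix (Fin n) (Fin 1) 𝕂)
    (η : 𝕂) (hF₁ : IsUnit F₁) (hF₂ : IsUnit F₂)
    (hX₁ : X₁ ≠ 0) (hX₂ : X₂ ≠ 0) (hY₁ : Y₁ ≠ 0) (hY₂ : Y₂ ≠ 0)
    (heq : Y₁ᵀ * F₁⁻¹ * X₁ = Y₂ᵀ * F₂⁻¹ * X₂) (hne : Y₁ᵀ * F₁⁻¹ * X₁ ≠ 0) :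
    ∃ R : Matrix (Fin n) (Fin n) 𝕂, IsUnit R ∧
      fromBlocks F₂ X₂ Y₂ᵀ (η • 1) =
        fromBlocks (F₂ * R⁻¹ * F₁⁻¹) 0 0 1 * fromBlocks F₁ X₁ Y₁ᵀ (η • 1) *
          fromBlocks R 0 0 1 := by
  rw [Matrix.mul_assoc, Matrix.mul_assoc] at heq
  rw [Matrix.mul_assoc] at hne
  have hd₁ := (Matrix.isUnit_iff_isUnit_det _).mp hF₁
  have hd₂ := (Matrix.isUnit_iff_isUnit_det _).mp hF₂
  have hX : X₂ = F₂ * (F₂⁻¹ * X₂) := by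
    rw [← Matrix.mul_assoc, Matrix.mul_nonsing_inv _ hd₂, Matrix.one_mul]
  obtain ⟨u₁, hu₁⟩ : ∃ u, u = F₁⁻¹ * X₁ := ⟨_, rfl⟩
  obtain ⟨u₂, hu₂⟩ : ∃ u, u = F₂⁻¹ * X₂ := ⟨_, rfl⟩
  rw [← hu₁, ← hu₂] at heq
  rw [← hu₁] at hne
  rw [← hu₂] at hX
  have h1 : u₁ ≠ 0 := by
    rintro rfl
    simp at hne
  have h2 : u₂ ≠ 0 := by
    rintro rfl
    rw [heq] at hne
    simp at hne
  obtain ⟨A, B, hAB, hBA, hA⟩ := exists_unit_mul_eq u₂ u₁ h2 h1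
  obtain ⟨c, hc⟩ : ∃ c : 𝕂, Y₁ᵀ * u₁ = c • (1 : Matrix (Fin 1) (Fin 1) 𝕂) := by
    refine ⟨(Y₁ᵀ * u₁) 0 0, ?_⟩
    ext i j
    rw [Subsingleton.elim i 0, Subsingleton.elim j 0]
    simp
  have hc0 : c ≠ 0 := by
    rintro rfl
    rw [hc] at hne
    simp at hne
  have hB : B * u₁ = u₂ := by
    rw [← hA, ← Matrix.mul_assoc, hBA, Matrix.one_mul]
  obtain ⟨z, hz⟩ : ∃ z, z = Y₂ᵀ * B - Y₁ᵀ := ⟨_, rfl⟩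
  have hzu : z * u₁ = 0 := by
    rw [hz, Matrix.sub_mul, Matrix.mul_assoc, hB, heq, sub_self]
  have hN : u₁ * z * (u₁ * z) = 0 := by
    rw [Matrix.mul_assoc, ← Matrix.mul_assoc z, hzu, Matrix.zero_mul, Matrix.mul_zero]
  have hC : (1 + c⁻¹ • (u₁ * z)) * (1 - c⁻¹ • (u₁ * z)) = 1 := by
    simp [Matrix.add_mul, Matrix.mul_sub, hN]
  have hR : ((1 + c⁻¹ • (u₁ * z)) * A) * (B * (1 - c⁻¹ • (u₁ * z))) = 1 := by
    rw [Matrix.mul_assoc, ← Matrix.mul_assoc A, hAB, Matrix.one_mul, hC]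
  have hRu : ((1 + c⁻¹ • (u₁ * z)) * A) * u₂ = u₁ := by
    rw [Matrix.mul_assoc, hA, Matrix.add_mul, Matrix.smul_mul, Matrix.mul_assoc, hzu]
    simp
  have hYR : Y₁ᵀ * ((1 + c⁻¹ • (u₁ * z)) * A) = Y₂ᵀ := by
    rw [← Matrix.mul_assoc, Matrix.mul_add, Matrix.mul_smul, ← Matrix.mul_assoc, hc,
      Matrix.smul_mul, smul_smul, inv_mul_cancel₀ hc0, one_smul, Matrix.one_mul,
      Matrix.mul_one, hz, add_sub_cancel, Matrix.mul_assoc, hBA, Matrix.mul_one]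
  generalize (1 + c⁻¹ • (u₁ * z)) * A = R at hR hRu hYR
  generalize B * (1 - c⁻¹ • (u₁ * z)) = S at hR
  have hSR : S * R = 1 := mul_eq_one_comm.mp hR
  refine ⟨R, ⟨⟨R, S, hR, hSR⟩, rfl⟩, ?_⟩
  rw [Matrix.inv_eq_right_inv hR]
  have e1 : F₂ * S * F₁⁻¹ * F₁ * R = F₂ := by
    rw [Matrix.mul_assoc (F₂ * S), Matrix.nonsing_inv_mul _ hd₁, Matrix.mul_one,
      Matrix.mul_assoc, hSR, Matrix.mul_one]
  have e2 : F₂ * S * F₁⁻¹ * X₁ = X₂ := by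
    rw [Matrix.mul_assoc, ← hu₁, ← hRu, Matrix.mul_assoc, ← Matrix.mul_assoc S, hSR,
      Matrix.one_mul, ← hX]
  simp only [Matrix.fromBlocks_multiply, Matrix.zero_mul, Matrix.mul_zero, add_zero, zero_add,
    Matrix.one_mul, Matrix.mul_one, e1, e2, hYR]
end

section
/- For n ≥ 1 and 𝕂 = ℝ or ℂ, there exist two n×n matrices A, B over 𝕂 such that the semigroup generated by A and B (all finite products of A's and B's) is dense in the set of all n×n matrices over 𝕂. -/
namespace DenseSG

open Real Set Filter Topology

/-- The open sets whose intersection gives the generic parameters. -/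
def goodSet (N : ℕ) (U : Set (ℝ × ℝ × ℝ)) (i : ℕ) : Set (ℝ × ℝ × ℝ) :=
  {p | 0 < p.1} ∪ ⋃ (m' : ℕ) (k : ℕ) (j : ℤ) (l : ℤ) (_ : 1 ≤ i + N * m') (_ : 1 ≤ k),
    {p : ℝ × ℝ × ℝ | (((i + N * m' : ℕ) : ℝ) + k * p.1, k * p.2.1 - 2 * π * j,
      ((i + N * m' : ℕ) : ℝ) * p.2.2 - 2 * π * l) ∈ U}

lemma isOpen_goodSet (N : ℕ) (U : Set (ℝ × ℝ × ℝ)) (hU : IsOpen U) (i : ℕ) :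
    IsOpen (goodSet N U i) := by
  unfold goodSet
  refine IsOpen.union (isOpen_lt continuous_const continuous_fst) ?_
  refine isOpen_iUnion fun m' => isOpen_iUnion fun k => isOpen_iUnion fun j =>
    isOpen_iUnion fun l => isOpen_iUnion fun _ => isOpen_iUnion fun _ => ?_
  exact hU.preimage (by fun_prop)

lemma approx_angle (c x y : ℝ) (hc : 0 < c) :
    ∃ j : ℤ, |(x + 2 * π * j) / c - y| ≤ 2 * π / c := by
  refine ⟨⌊(c * y - x) / (2 * π)⌋, ?_⟩
  have h1 := Int.floor_le ((c * y - x) / (2 * π))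
  have h2 := Int.lt_floor_add_one ((c * y - x) / (2 * π))
  set j : ℤ := ⌊(c * y - x) / (2 * π)⌋
  have hp : 0 < 2 * π := by positivity
  rw [le_div_iff₀ hp] at h1
  rw [div_lt_iff₀ hp] at h2
  have : (x + 2 * π * j) / c - y = (x + 2 * π * j - c * y) / c := by field_simp
  rw [this, abs_div, abs_of_pos hc]
  gcongr
  rw [abs_le]
  constructor <;> nlinarith

lemma dense_goodSet (N : ℕ) (hN : 1 ≤ N) (U : Set (ℝ × ℝ × ℝ)) (hU : U.Nonempty) (i : ℕ) :
    Dense (goodSet N U i) := by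
  obtain ⟨⟨x, φ, ψ⟩, hx⟩ := hU
  rw [Metric.dense_iff]
  rintro ⟨σ, θ, η⟩ ε hε
  rcases le_or_gt 0 σ with hσ | hσ
  · refine ⟨(σ + ε / 2, θ, η), ?_, Or.inl ?_⟩
    · simp [Prod.dist_eq, abs_of_pos hε, hε]
    · simp; linarith
  -- choose `k` large
  have hNr : (1 : ℝ) ≤ N := by exact_mod_cast hN
  have hσ' : 0 < -σ := by linarith
  obtain ⟨k, hk⟩ := exists_nat_gt (1 + N / ε + 2 * π / ε + (|x| + i + 1 + 2 * π / ε) / (-σ))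
  have hpi := Real.pi_pos
  have e1 : 0 ≤ N / ε := by positivity
  have e2 : 0 ≤ 2 * π / ε := by positivity
  have e3 : 0 ≤ (|x| + i + 1 + 2 * π / ε) / (-σ) := by positivity
  have hk0 : (1 : ℝ) < k := by linarith
  have hkpos : (0 : ℝ) < k := by linarith
  have hk1 : (N : ℝ) / k < ε := by
    rw [div_lt_iff₀ hkpos]
    have : N / ε < k := by linarith
    rw [div_lt_iff₀ hε] at this; linarith
  have hk2 : 2 * π / k < ε := by
    rw [div_lt_iff₀ hkpos]
    have : 2 * π / ε < k := by linarith
    rw [div_lt_iff₀ hε] at this; linarith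
  have hk3 : |x| + i + 1 + 2 * π / ε < k * (-σ) := by
    rw [← div_lt_iff₀ hσ']; linarith
  have hax := neg_abs_le x
  have hi0 : (0 : ℝ) ≤ i := by positivity
  have hNp : (0 : ℝ) < N := by linarith
  set m' := ⌈(x - k * σ - i) / N⌉₊ with hm'
  have hm1 : (x - k * σ - i) / N ≤ m' := Nat.le_ceil _
  have hm2 : (m' : ℝ) < (x - k * σ - i) / N + 1 := Nat.ceil_lt_add_one (by
    apply div_nonneg _ hNp.le; nlinarith)
  rw [div_le_iff₀ hNp] at hm1
  have hm3 : (m' : ℝ) * N < x - k * σ - i + N := by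
    have := mul_lt_mul_of_pos_right hm2 hNp
    rw [add_mul, div_mul_cancel₀ _ hNp.ne'] at this; linarith
  set m : ℕ := i + N * m' with hm
  have hmr : (m : ℝ) = i + m' * N := by rw [hm]; push_cast; ring
  have hmlow : x - k * σ ≤ m := by linarith
  have hmhigh : (m : ℝ) < x - k * σ + N := by linarith
  have hmbig : 1 + 2 * π / ε < m := by nlinarith
  have hmpos : (0 : ℝ) < m := by linarith
  have hm4 : 2 * π / m < ε := by
    rw [div_lt_iff₀ hmpos]
    have : 2 * π / ε < m := by linarith
    rw [div_lt_iff₀ hε] at this; linarith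
  obtain ⟨j, hj⟩ := approx_angle k φ θ hkpos
  obtain ⟨l, hl⟩ := approx_angle m ψ η hmpos
  refine ⟨((x - m) / k, (φ + 2 * π * j) / k, (ψ + 2 * π * l) / m), ?_, Or.inr ?_⟩
  · rw [Metric.mem_ball, Prod.dist_eq, Prod.dist_eq]
    refine max_lt ?_ (max_lt (lt_of_le_of_lt hj hk2) (lt_of_le_of_lt hl hm4))
    rw [Real.dist_eq]
    refine lt_of_le_of_lt ?_ hk1
    have : (x - m) / k - σ = (x - m - k * σ) / k := by field_simp
    simp only [this, abs_div, abs_of_pos hkpos]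
    gcongr
    rw [abs_le]; constructor <;> linarith
  · simp only [mem_iUnion]
    refine ⟨m', k, j, l, ?_, ?_, ?_⟩
    · exact_mod_cast hmpos
    · exact_mod_cast hk0.le
    · rw [← hm]
      simp only [mem_ofPred_eq]
      convert hx using 2
      · field_simp; ring
      · congr 1 <;> field_simp <;> ring

lemma exists_params (N : ℕ) (hN : 1 ≤ N) : ∃ σ θ η : ℝ, ∀ U : Set (ℝ × ℝ × ℝ), IsOpen U →
    U.Nonempty → ∀ i : ℕ, ∃ (m' k : ℕ) (j l : ℤ), 1 ≤ i + N * m' ∧ 1 ≤ k ∧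
      (((i + N * m' : ℕ) : ℝ) + k * σ, k * θ - 2 * π * j,
        ((i + N * m' : ℕ) : ℝ) * η - 2 * π * l) ∈ U := by
  let ℬ := TopologicalSpace.countableBasis (ℝ × ℝ × ℝ)
  have hc : Countable ℬ := (TopologicalSpace.countable_countableBasis _).to_subtype
  have hD : Dense (⋂ q : ℬ × ℕ, goodSet N q.1.1 q.2) := by
    apply dense_iInter_of_isOpen
    · intro q
      exact isOpen_goodSet _ _ (TopologicalSpace.isOpen_of_mem_countableBasis q.1.2) _
    · intro q
      exact dense_goodSet _ hN _ (TopologicalSpace.nonempty_of_mem_countableBasis q.1.2) _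
  obtain ⟨⟨σ, θ, η⟩, hp, hs⟩ := hD.inter_open_nonempty {p : ℝ × ℝ × ℝ | p.1 < 0}
    (isOpen_lt continuous_fst continuous_const) ⟨(-1, 0, 0), by simp⟩
  refine ⟨σ, θ, η, fun U hU ⟨u, hu⟩ i => ?_⟩
  obtain ⟨V, hV, huV, hVU⟩ :=
    (TopologicalSpace.isBasis_countableBasis (ℝ × ℝ × ℝ)).exists_subset_of_mem_open hu hU
  have := mem_iInter.1 hs (⟨V, hV⟩, i)
  rcases this with h | h
  · simp at h hp; linarith
  · simp only [mem_iUnion] at h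
    obtain ⟨m', k, j, l, h1, h2, h3⟩ := h
    exact ⟨m', k, j, l, h1, h2, hVU h3⟩

/-- The closure of the semigroup generated by two matrices. -/
lemma core {𝕂 : Type*} [RCLike 𝕂] {n : ℕ} (e : ℝ → 𝕂) (hec : Continuous e)
    (hadd : ∀ x y, e (x + y) = e x * e y) (h0 : e 0 = 1) (hper : e (2 * π) = 1)
    (N : ℕ) (hN : 1 ≤ N) (Z : Matrix (Fin n) (Fin n) 𝕂) (hZ : Z ^ N = 1)
    (R : ℝ → Matrix (Fin n) (Fin n) 𝕂) (hRc : Continuous R)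
    (hRadd : ∀ x y, R (x + y) = R x * R y) (hR0 : R 0 = 1) (hRper : R (2 * π) = 1) :
    ∃ A B : Matrix (Fin n) (Fin n) 𝕂, ∃ S : Submonoid (Matrix (Fin n) (Fin n) 𝕂),
      IsClosed (S : Set (Matrix (Fin n) (Fin n) 𝕂)) ∧
      (S : Set (Matrix (Fin n) (Fin n) 𝕂)) ⊆
        closure ((Subsemigroup.closure {A, B} : Subsemigroup (Matrix (Fin n) (Fin n) 𝕂)) :
        Set (Matrix (Fin n) (Fin n) 𝕂)) ∧
      ∀ (x φ ψ : ℝ) (i : ℕ), (((Real.exp x : ℝ) : 𝕂) * e ψ) • (Z ^ i * R φ) ∈ S := by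
  obtain ⟨σ, θ, η, h⟩ := exists_params N hN
  have epow : ∀ (x : ℝ) (k : ℕ), e (k * x) = e x ^ k := by
    intro x k
    induction k with
    | zero => simp [h0]
    | succ k ih => rw [pow_succ, ← ih, ← hadd]; congr 1; push_cast; ring
  have Rpow : ∀ (x : ℝ) (k : ℕ), R (k * x) = R x ^ k := by
    intro x k
    induction k with
    | zero => simp [hR0]
    | succ k ih => rw [pow_succ, ← ih, ← hRadd]; congr 1; push_cast; ring
  have hepf : Function.Periodic e (2 * π) := fun x => by rw [hadd, hper, mul_one]
  have hRpf : Function.Periodic R (2 * π) := fun x => by rw [hRadd, hRper, mul_one]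
  have eper : ∀ (x : ℝ) (j : ℤ), e (x - 2 * π * j) = e x := by
    intro x j
    have := hepf.sub_int_mul_eq (x := x) j
    rwa [mul_comm] at this
  have Rper : ∀ (x : ℝ) (j : ℤ), R (x - 2 * π * j) = R x := by
    intro x j
    have := hRpf.sub_int_mul_eq (x := x) j
    rwa [mul_comm] at this
  let A : Matrix (Fin n) (Fin n) 𝕂 := (((Real.exp 1 : ℝ) : 𝕂) * e η) • Z
  let B : Matrix (Fin n) (Fin n) 𝕂 := ((Real.exp σ : ℝ) : 𝕂) • R θ
  let G := Subsemigroup.closure {A, B}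
  have hpowS : ∀ (X : Matrix (Fin n) (Fin n) 𝕂), X ∈ G → ∀ k : ℕ, 1 ≤ k → X ^ k ∈ G := by
    intro X hX k hk
    induction k, hk using Nat.le_induction with
    | base => simpa
    | succ k hk ih => rw [pow_succ]; exact mul_mem ih hX
  have hA : A ∈ G := Subsemigroup.subset_closure (by simp)
  have hB : B ∈ G := Subsemigroup.subset_closure (by simp)
  have key : ∀ (x φ ψ : ℝ) (i : ℕ),
      (((Real.exp x : ℝ) : 𝕂) * e ψ) • (Z ^ i * R φ) ∈ closure (G : Set _) := by
    intro x φ ψ i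
    let F : ℝ × ℝ × ℝ → Matrix (Fin n) (Fin n) 𝕂 := fun p =>
      (((Real.exp p.1 : ℝ) : 𝕂) * e p.2.2) • (Z ^ i * R p.2.1)
    have hF : Continuous F := by
      have : Continuous (fun p : ℝ × ℝ × ℝ => ((Real.exp p.1 : ℝ) : 𝕂)) :=
        RCLike.continuous_ofReal.comp (by fun_prop)
      fun_prop
    rw [_root_.mem_closure_iff]
    intro O hO hmem
    obtain ⟨m', k, j, l, h1, h2, h3⟩ := h (F ⁻¹' O) (hO.preimage hF) ⟨(x, φ, ψ), hmem⟩ i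
    refine ⟨_, h3, ?_⟩
    rw [SetLike.mem_coe]
    have : A ^ (i + N * m') * B ^ k ∈ G := mul_mem (hpowS _ hA _ h1) (hpowS _ hB _ h2)
    convert this using 1
    have hZ' : Z ^ (i + N * m') = Z ^ i := by rw [pow_add, pow_mul, hZ, one_pow, mul_one]
    simp only [F, A, B, smul_pow, eper, Rper, epow, Rpow, hZ', Real.exp_add, Matrix.smul_mul,
      Matrix.mul_smul, smul_smul, mul_pow]
    congr 1
    have e1 : Real.exp ((i + N * m' : ℕ) : ℝ) = Real.exp 1 ^ (i + N * m') := by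
      rw [← Real.exp_nat_mul, mul_one]
    rw [e1, Real.exp_nat_mul]
    push_cast
    ring
  refine ⟨A, B, ⟨⟨closure (G : Set _), ?_⟩, ?_⟩, isClosed_closure, subset_rfl, key⟩
  · intro a b ha hb
    exact G.topologicalClosure.mul_mem ha hb
  · have := key 0 0 0 0
    simpa [h0, hR0] using this


variable {𝕂 : Type*} [RCLike 𝕂] {n : ℕ}

/-- Rotation of angle `φ`. -/
noncomputable def rot (𝕂 : Type*) [RCLike 𝕂] (φ : ℝ) : Matrix (Fin 2) (Fin 2) 𝕂 :=
  !![((Real.cos φ : ℝ) : 𝕂), -((Real.sin φ : ℝ) : 𝕂); ((Real.sin φ : ℝ) : 𝕂), ((Real.cos φ : ℝ) : 𝕂)]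

lemma rot_add (x y : ℝ) : rot 𝕂 (x + y) = rot 𝕂 x * rot 𝕂 y := by
  ext i j
  fin_cases i <;> fin_cases j <;>
    simp [rot, Matrix.mul_apply, Fin.sum_univ_two, Real.cos_add, Real.sin_add] <;> ring

lemma rot_zero : rot 𝕂 0 = 1 := by
  ext i j
  fin_cases i <;> fin_cases j <;> simp [rot]

lemma rot_two_pi : rot 𝕂 (2 * π) = 1 := by
  ext i j
  fin_cases i <;> fin_cases j <;> simp [rot]

lemma rot_continuous : Continuous (rot 𝕂) := by
  refine continuous_matrix fun i j => ?_
  have h1 : Continuous (fun φ : ℝ => ((Real.cos φ : ℝ) : 𝕂)) :=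
    RCLike.continuous_ofReal.comp Real.continuous_cos
  have h2 : Continuous (fun φ : ℝ => ((Real.sin φ : ℝ) : 𝕂)) :=
    RCLike.continuous_ofReal.comp Real.continuous_sin
  fin_cases i <;> fin_cases j
  · exact h1
  · exact h2.neg
  · exact h2
  · exact h1

lemma rot_pi_div_two : rot 𝕂 (π / 2) = !![0, -1; 1, 0] := by
  simp [rot]

lemma rot_neg_pi_div_two : rot 𝕂 (-(π / 2)) = !![0, 1; -1, 0] := by
  simp [rot]

/-- A closed submonoid of `2 × 2` matrices containing two different circle groups contains all
elementary unipotents and the determinant one diagonal matrices. -/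
lemma two_by_two (K : Submonoid (Matrix (Fin 2) (Fin 2) 𝕂))
    (hK : IsClosed (K : Set (Matrix (Fin 2) (Fin 2) 𝕂))) (b : 𝕂) (ρ : ℝ) (hρ : 1 < ρ)
    (hb : b ^ 8 = ((ρ : ℝ) : 𝕂)) (hspan : ∀ x : 𝕂, ∃ r s : ℝ, x = (r : 𝕂) + (s : 𝕂) * b ^ 2)
    (hrot : ∀ φ, rot 𝕂 φ ∈ K)
    (hrot' : ∀ φ : ℝ, !![((Real.cos φ : ℝ) : 𝕂), -(b⁻¹ * ((Real.sin φ : ℝ) : 𝕂));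
      b * ((Real.sin φ : ℝ) : 𝕂), ((Real.cos φ : ℝ) : 𝕂)] ∈ K) :
    (∀ x : 𝕂, !![1, x; 0, 1] ∈ K) ∧ (∀ x : 𝕂, !![1, 0; x, 1] ∈ K) ∧
    (∀ y : 𝕂, y ≠ 0 → !![y, 0; 0, y⁻¹] ∈ K) := by
  have hb0 : b ≠ 0 := by
    rintro rfl
    have : ((ρ : ℝ) : 𝕂) = 0 := by rw [← hb]; simp
    rw [RCLike.ofReal_eq_zero] at this
    linarith
  have hD : !![b, 0; 0, b⁻¹] ∈ K := by
    have := K.mul_mem (hrot (π / 2)) (hrot' (-(π / 2)))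
    rw [rot_pi_div_two] at this
    simpa using this
  have hD' : !![b⁻¹, 0; 0, b] ∈ K := by
    have := K.mul_mem (hrot' (π / 2)) (hrot (-(π / 2)))
    rw [rot_neg_pi_div_two] at this
    simpa using this
  have hconj : ∀ p q r s : 𝕂, !![p, q; r, s] ∈ K →
      !![p, b ^ 2 * q; (b ^ 2)⁻¹ * r, s] ∈ K := by
    intro p q r s h
    have := K.mul_mem (K.mul_mem hD h) hD'
    convert this using 1
    ext i j
    fin_cases i <;> fin_cases j <;> simp [Matrix.mul_apply, Fin.sum_univ_two] <;>
      field_simp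
  have hconjk : ∀ k : ℕ, ∀ p q r s : 𝕂, !![p, q; r, s] ∈ K →
      !![p, (b ^ 2) ^ k * q; ((b ^ 2) ^ k)⁻¹ * r, s] ∈ K := by
    intro k
    induction k with
    | zero => intro p q r s h; simpa using h
    | succ k ih =>
      intro p q r s h
      convert hconj _ _ _ _ (ih _ _ _ _ h) using 1
      ext i j
      fin_cases i <;> fin_cases j <;> simp [pow_succ] <;> ring
  have hreal : ∀ r : ℝ, !![1, (r : 𝕂); 0, 1] ∈ K := by
    intro r
    have hlim : Tendsto (fun k : ℕ => r * (ρ⁻¹) ^ k) atTop (𝓝 0) := by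
      have := (tendsto_pow_atTop_nhds_zero_of_lt_one (r := ρ⁻¹) (by positivity)
        (inv_lt_one_of_one_lt₀ hρ)).const_mul r
      simpa using this
    have hsmall : ∀ᶠ k : ℕ in atTop, |r * (ρ⁻¹) ^ k| < 1 := by
      have := hlim.abs
      rw [abs_zero] at this
      exact this.eventually (gt_mem_nhds one_pos)
    let φ : ℕ → ℝ := fun k => Real.arcsin (-(r * (ρ⁻¹) ^ k))
    have hφ : Tendsto φ atTop (𝓝 0) := by
      have := (Real.continuous_arcsin.tendsto _).comp hlim.neg
      simpa [φ, Function.comp_def] using this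
    have hcos : Tendsto (fun k => ((Real.cos (φ k) : ℝ) : 𝕂)) atTop (𝓝 1) := by
      have := (RCLike.continuous_ofReal (K := 𝕂)).tendsto _ |>.comp
        ((Real.continuous_cos.tendsto _).comp hφ)
      simpa [Function.comp_def] using this
    have hlow : Tendsto (fun k : ℕ => ((((ρ⁻¹) ^ k * Real.sin (φ k)) : ℝ) : 𝕂)) atTop (𝓝 0) := by
      have h1 := (tendsto_pow_atTop_nhds_zero_of_lt_one (r := ρ⁻¹) (by positivity)
        (inv_lt_one_of_one_lt₀ hρ))
      have h2 := h1.mul ((Real.continuous_sin.tendsto _).comp hφ)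
      have := (RCLike.continuous_ofReal (K := 𝕂)).tendsto _ |>.comp h2
      simpa [Function.comp_def] using this
    have ht : Tendsto (fun k : ℕ => !![((Real.cos (φ k) : ℝ) : 𝕂), (r : 𝕂);
        ((((ρ⁻¹) ^ k * Real.sin (φ k)) : ℝ) : 𝕂), ((Real.cos (φ k) : ℝ) : 𝕂)]) atTop
        (𝓝 !![1, (r : 𝕂); 0, 1]) := by
      refine tendsto_pi_nhds.2 fun i => tendsto_pi_nhds.2 fun j => ?_
      fin_cases i <;> fin_cases j
      · exact hcos
      · exact tendsto_const_nhds
      · exact hlow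
      · exact hcos
    refine hK.mem_of_tendsto ht ?_
    filter_upwards [hsmall] with k hk
    have h1 := hconjk (4 * k) _ _ _ _ (hrot (φ k))
    have h2 : (b ^ 2) ^ (4 * k) = ((ρ ^ k : ℝ) : 𝕂) := by
      rw [← pow_mul, show 2 * (4 * k) = 8 * k by ring, pow_mul, hb]; push_cast; rfl
    rw [h2] at h1
    have hsin : Real.sin (φ k) = -(r * (ρ⁻¹) ^ k) := by
      rw [abs_lt] at hk
      exact Real.sin_arcsin (by linarith) (by linarith)
    have hρk : ρ ^ k ≠ 0 := by positivity
    rw [SetLike.mem_coe]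
    convert h1 using 1
    ext i j
    fin_cases i <;> fin_cases j
    · rfl
    · simp only [Matrix.of_apply, Matrix.cons_val', Matrix.cons_val_zero, Matrix.cons_val_one,
        Fin.zero_eta, Fin.mk_one, Matrix.cons_val_fin_one]
      rw [hsin]
      rw [← RCLike.ofReal_neg, ← RCLike.ofReal_mul]
      congr 1
      rw [inv_pow]; field_simp
    · simp
    · rfl
  have hup : ∀ x : 𝕂, !![1, x; 0, 1] ∈ K := by
    intro x
    obtain ⟨r, s, rfl⟩ := hspan x
    have h1 := hconj _ _ _ _ (hreal s)
    have h2 := K.mul_mem (hreal r) h1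
    convert h2 using 1
    ext i j
    fin_cases i <;> fin_cases j <;> simp [Matrix.mul_apply, Fin.sum_univ_two]; ring
  have hlo : ∀ x : 𝕂, !![1, 0; x, 1] ∈ K := by
    intro x
    have h2 := K.mul_mem (K.mul_mem (hrot (π / 2)) (hup (-x))) (hrot (-(π / 2)))
    rw [rot_pi_div_two, rot_neg_pi_div_two] at h2
    convert h2 using 1
    ext i j
    fin_cases i <;> fin_cases j <;> simp
  refine ⟨hup, hlo, fun y hy => ?_⟩
  have hw : ∀ y : 𝕂, y ≠ 0 → !![0, y; -y⁻¹, 0] ∈ K := by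
    intro y hy
    have := K.mul_mem (K.mul_mem (hup y) (hlo (-y⁻¹))) (hup y)
    convert this using 1
    ext i j
    fin_cases i <;> fin_cases j <;> simp [hy]
  have := K.mul_mem (hw y hy) (hw (-1) (by simp))
  convert this using 1
  ext i j
  fin_cases i <;> fin_cases j <;> simp

/-- The inclusion of the coordinate plane `(p, q)`. -/
def incl (𝕂 : Type*) [RCLike 𝕂] {n : ℕ} (p q : Fin n) : Matrix (Fin n) (Fin 2) 𝕂 :=
  Matrix.of fun i => ![if i = p then 1 else 0, if i = q then 1 else 0]

/-- A `2 × 2` matrix acting on the coordinate plane `(p, q)`. -/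
def emb (p q : Fin n) (X : Matrix (Fin 2) (Fin 2) 𝕂) : Matrix (Fin n) (Fin n) 𝕂 :=
  1 + incl 𝕂 p q * (X - 1) * (incl 𝕂 p q).transpose

lemma incl_transpose_mul {p q : Fin n} (h : p ≠ q) :
    (incl 𝕂 p q).transpose * incl 𝕂 p q = 1 := by
  ext i j
  fin_cases i <;> fin_cases j <;> simp [incl, Matrix.mul_apply, h, h.symm]

lemma emb_one (p q : Fin n) : emb p q (1 : Matrix (Fin 2) (Fin 2) 𝕂) = 1 := by
  simp [emb]

lemma emb_mul {p q : Fin n} (h : p ≠ q) (X Y : Matrix (Fin 2) (Fin 2) 𝕂) :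
    emb p q (X * Y) = emb p q X * emb p q Y := by
  have e : X * Y - 1 = (X - 1) + (Y - 1) + (X - 1) * (Y - 1) := by noncomm_ring
  have e2 : incl 𝕂 p q * (X - 1) * (incl 𝕂 p q).transpose *
      (incl 𝕂 p q * (Y - 1) * (incl 𝕂 p q).transpose) =
      incl 𝕂 p q * ((X - 1) * (Y - 1)) * (incl 𝕂 p q).transpose := by
    calc _ = incl 𝕂 p q * (X - 1) * ((incl 𝕂 p q).transpose *
      incl 𝕂 p q) * (Y - 1) * (incl 𝕂 p q).transpose := by simp only [Matrix.mul_assoc]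
      _ = _ := by rw [incl_transpose_mul h]; simp only [Matrix.mul_assoc, Matrix.one_mul]
  unfold emb
  rw [e, add_mul, mul_add, one_mul, mul_add, mul_one, e2, one_mul, Matrix.mul_add, Matrix.mul_add,
    Matrix.add_mul, Matrix.add_mul]
  abel

lemma emb_continuous (p q : Fin n) : Continuous (emb (𝕂 := 𝕂) p q) := by
  unfold emb
  fun_prop

/-- `emb` as a monoid homomorphism. -/
def embHom {p q : Fin n} (h : p ≠ q) :
    Matrix (Fin 2) (Fin 2) 𝕂 →* Matrix (Fin n) (Fin n) 𝕂 where
  toFun := emb p q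
  map_one' := emb_one p q
  map_mul' := emb_mul h

lemma emb_apply (p q : Fin n) (X : Matrix (Fin 2) (Fin 2) 𝕂) (i j : Fin n) :
    emb p q X i j = (if i = j then 1 else 0) +
      ((if i = p then (if j = p then X 0 0 - 1 else 0) + (if j = q then X 0 1 else 0) else 0) +
      (if i = q then (if j = p then X 1 0 else 0) + (if j = q then X 1 1 - 1 else 0) else 0)) := by
  simp only [emb, Matrix.add_apply, Matrix.one_apply]
  congr 1
  simp only [Matrix.mul_apply, Fin.sum_univ_two, incl, Matrix.of_apply, Matrix.transpose_apply]
  simp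
  split_ifs <;> ring

lemma emb_swap (p q : Fin n) (x y z w : 𝕂) :
    emb q p !![x, y; z, w] = emb p q !![w, z; y, x] := by
  ext i j
  simp only [emb_apply]
  simp
  split_ifs <;> ring

/-- Conjugation of embedded matrices. -/
lemma conj_emb {W W' : Matrix (Fin n) (Fin n) 𝕂} (hW : W * W' = 1) {p q r s : Fin n}
    {Δ X X' : Matrix (Fin 2) (Fin 2) 𝕂} (h1 : W * incl 𝕂 p q = incl 𝕂 r s * Δ)
    (h2 : (incl 𝕂 r s).transpose * W = Δ * (incl 𝕂 p q).transpose) (h3 : Δ * X = X' * Δ) :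
    W * emb p q X * W' = emb r s X' := by
  have : W * emb p q X = emb r s X' * W := by
    unfold emb
    rw [mul_add, add_mul, mul_one, one_mul]
    congr 1
    calc W * (incl 𝕂 p q * (X - 1) * (incl 𝕂 p q).transpose)
        = (W * incl 𝕂 p q) * (X - 1) * (incl 𝕂 p q).transpose := by
          simp only [Matrix.mul_assoc]
      _ = incl 𝕂 r s * (Δ * (X - 1)) * (incl 𝕂 p q).transpose := by
          rw [h1]; simp only [Matrix.mul_assoc]
      _ = incl 𝕂 r s * ((X' - 1) * Δ) * (incl 𝕂 p q).transpose := by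
          rw [mul_sub, sub_mul, h3, mul_one, one_mul]
      _ = incl 𝕂 r s * (X' - 1) * (Δ * (incl 𝕂 p q).transpose) := by
          simp only [Matrix.mul_assoc]
      _ = _ := by rw [← h2]; simp only [Matrix.mul_assoc]
  rw [this, mul_assoc, hW, mul_one]

/-- Moving the second coordinate with a quarter turn. -/
lemma move_emb (S : Submonoid (Matrix (Fin n) (Fin n) 𝕂)) {i j k : Fin n} (hij : i ≠ j)
    (hjk : j ≠ k) (hik : i ≠ k) (hrot : ∀ φ, emb j k (rot 𝕂 φ) ∈ S)
    {X : Matrix (Fin 2) (Fin 2) 𝕂} (hX : emb i j X ∈ S) : emb i k X ∈ S := by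
  have hW : emb j k (rot 𝕂 (π / 2)) * emb j k (rot 𝕂 (-(π / 2))) = 1 := by
    rw [← emb_mul hjk, rot_pi_div_two, rot_neg_pi_div_two, ← emb_one j k]
    congr 1
    ext a b
    fin_cases a <;> fin_cases b <;> simp
  have := S.mul_mem (S.mul_mem (hrot (π / 2)) hX) (hrot (-(π / 2)))
  rwa [conj_emb (r := i) (s := k) (Δ := 1) (X' := X) hW] at this
  · ext x c
    rw [Matrix.mul_one, Matrix.mul_apply]
    fin_cases c <;> simp [incl, emb_apply, rot_pi_div_two] <;> grind
  · ext c x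
    rw [Matrix.one_mul, Matrix.mul_apply]
    fin_cases c <;> simp [incl, emb_apply, rot_pi_div_two] <;> grind
  · simp

lemma rot_symm (S : Submonoid (Matrix (Fin n) (Fin n) 𝕂)) {i j : Fin n}
    (hrot : ∀ φ, emb i j (rot 𝕂 φ) ∈ S) (φ : ℝ) : emb j i (rot 𝕂 φ) ∈ S := by
  have := hrot (-φ)
  rw [rot, emb_swap] at this
  simpa [rot] using this

lemma transvection_eq_emb (i j : Fin n) (x : 𝕂) :
    Matrix.transvection i j x = emb i j !![1, x; 0, 1] := by
  ext a b
  rw [emb_apply, Matrix.transvection, Matrix.add_apply, Matrix.one_apply, Matrix.single_apply]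
  simp
  grind

lemma emb_diag {i j : Fin n} (hij : i ≠ j) (y z : 𝕂) :
    emb i j !![y, 0; 0, z] =
      Matrix.diagonal (fun a => if a = i then y else if a = j then z else 1) := by
  ext a b
  rw [emb_apply, Matrix.diagonal_apply]
  simp
  grind

/-- The phase function. -/
lemma exists_phase (𝕂 : Type*) [RCLike 𝕂] : ∃ e : ℝ → 𝕂, Continuous e ∧
    (∀ x y, e (x + y) = e x * e y) ∧ e 0 = 1 ∧ e (2 * π) = 1 ∧
    (∀ x : 𝕂, ∃ r s : ℝ, x = (r : 𝕂) + (s : 𝕂) * e (π / 2)) ∧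
    (∀ z : 𝕂, z ≠ 0 → ∃ (x ψ : ℝ) (k : ℕ), z = (-1) ^ k * (((Real.exp x : ℝ) : 𝕂) * e ψ)) := by
  by_cases hI : (RCLike.I : 𝕂) = 0
  · have hre : ∀ z : 𝕂, z = ((RCLike.re z : ℝ) : 𝕂) := fun z => by
      conv_lhs => rw [← RCLike.re_add_im z, hI, mul_zero, add_zero]
    refine ⟨fun _ => 1, continuous_const, by simp, rfl, rfl, fun x => ⟨RCLike.re x, 0, ?_⟩, ?_⟩
    · simpa using hre x
    · intro z hz
      have hz' : RCLike.re z ≠ 0 := fun h => hz (by rw [hre z, h]; simp)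
      rcases lt_or_gt_of_ne hz' with h | h
      · refine ⟨Real.log (-(RCLike.re z)), 0, 1, ?_⟩
        rw [Real.exp_log (by linarith)]
        simpa using hre z
      · refine ⟨Real.log (RCLike.re z), 0, 0, ?_⟩
        rw [Real.exp_log h]
        simpa using hre z
  · have hII := RCLike.I_mul_I_of_nonzero hI
    refine ⟨fun x => ((Real.cos x : ℝ) : 𝕂) + ((Real.sin x : ℝ) : 𝕂) * RCLike.I, ?_, ?_, by simp,
      by simp, fun x => ⟨RCLike.re x, RCLike.im x, ?_⟩, ?_⟩
    · have h1 : Continuous (fun φ : ℝ => ((Real.cos φ : ℝ) : 𝕂)) :=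
        RCLike.continuous_ofReal.comp Real.continuous_cos
      have h2 : Continuous (fun φ : ℝ => ((Real.sin φ : ℝ) : 𝕂)) :=
        RCLike.continuous_ofReal.comp Real.continuous_sin
      fun_prop
    · intro x y
      simp only [Real.cos_add, Real.sin_add]
      push_cast
      linear_combination (-(Real.sin x : 𝕂) * (Real.sin y : 𝕂)) * hII
    · simp [RCLike.re_add_im]
    · intro z hz
      let w : ℂ := ⟨RCLike.re z, RCLike.im z⟩
      have hw : w ≠ 0 := by
        intro h
        apply hz
        have h1 : RCLike.re z = 0 := congrArg Complex.re h
        have h2 : RCLike.im z = 0 := congrArg Complex.im h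
        rw [← RCLike.re_add_im z, h1, h2]; simp
      have hn : 0 < ‖w‖ := norm_pos_iff.2 hw
      refine ⟨Real.log ‖w‖, Complex.arg w, 0, ?_⟩
      rw [Real.exp_log hn]
      have h1 : ‖w‖ * Real.cos (Complex.arg w) = RCLike.re z := Complex.norm_mul_cos_arg w
      have h2 : ‖w‖ * Real.sin (Complex.arg w) = RCLike.im z := Complex.norm_mul_sin_arg w
      conv_lhs => rw [← RCLike.re_add_im z, ← h1, ← h2]
      push_cast
      ring

/-- If the closed submonoid contains all transvections, embedded diagonal matrices of determinant
one and elements of every nonzero determinant, then it is everything. -/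
lemma eq_univ_of {d : ℕ} (S : Submonoid (Matrix (Fin (d + 1)) (Fin (d + 1)) 𝕂))
    (hS : IsClosed (S : Set (Matrix (Fin (d + 1)) (Fin (d + 1)) 𝕂)))
    (htrans : ∀ i j, i ≠ j → ∀ x : 𝕂, emb i j !![1, x; 0, 1] ∈ S)
    (hdiag : ∀ i j, i ≠ j → ∀ y : 𝕂, y ≠ 0 → emb i j !![y, 0; 0, y⁻¹] ∈ S)
    (hdet : ∀ z : 𝕂, z ≠ 0 → ∃ h ∈ S, h.det = z) (M : Matrix (Fin (d + 1)) (Fin (d + 1)) 𝕂) :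
    M ∈ S := by
  have htr : ∀ t : Matrix.TransvectionStruct (Fin (d + 1)) 𝕂, t.toMatrix ∈ S := by
    rintro ⟨i, j, hij, c⟩
    rw [Matrix.TransvectionStruct.toMatrix_mk, transvection_eq_emb]
    exact htrans i j hij c
  -- diagonal matrices of determinant one
  have hd0 : ∀ (D : Fin (d + 1) → 𝕂), (∀ i, D i ≠ 0) → ∀ s : Finset (Fin (d + 1)), 0 ∉ s →
      Matrix.diagonal (fun j => if j ∈ s then D j else if j = 0 then (∏ i ∈ s, D i)⁻¹ else 1) ∈ S
      := by
    intro D hD s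
    induction s using Finset.induction_on with
    | empty =>
      intro _
      have : (fun j : Fin (d + 1) => if j ∈ (∅ : Finset (Fin (d + 1))) then D j else
        if j = 0 then (∏ i ∈ (∅ : Finset (Fin (d + 1))), D i)⁻¹ else 1) = fun _ => 1 := by
        ext j; simp
      rw [this, Matrix.diagonal_one]
      exact S.one_mem
    | insert a s ha ih =>
      intro h0
      have ha0 : a ≠ 0 := fun h => h0 (by simp [h])
      have hs0 : 0 ∉ s := fun h => h0 (by simp [h])
      have h1 := S.mul_mem (hdiag a 0 ha0 (D a) (hD a)) (ih hs0)
      rw [emb_diag ha0, Matrix.diagonal_mul_diagonal] at h1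
      convert h1 using 2
      ext j
      by_cases hja : j = a
      · subst hja; simp [ha, ha0]
      · by_cases hj0 : j = 0
        · subst hj0
          simp [hs0, Finset.prod_insert ha, ha0.symm]
          ring
        · simp [hja, hj0]
  have hd1 : ∀ (D : Fin (d + 1) → 𝕂), Matrix.det (Matrix.diagonal D) = 1 →
      Matrix.diagonal D ∈ S := by
    intro D hD
    rw [Matrix.det_diagonal] at hD
    have hne : ∀ i, D i ≠ 0 := fun i hi => by
      rw [Finset.prod_eq_zero (Finset.mem_univ i) hi] at hD
      exact zero_ne_one hD
    have := hd0 D hne (Finset.univ.erase 0) (by simp)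
    convert this using 2
    ext j
    by_cases hj : j = 0
    · subst hj
      rw [← Finset.mul_prod_erase _ _ (Finset.mem_univ (0 : Fin (d + 1)))] at hD
      simp
      exact eq_inv_of_mul_eq_one_left hD
    · simp [hj]
  have hsl : ∀ X : Matrix (Fin (d + 1)) (Fin (d + 1)) 𝕂, X.det = 1 → X ∈ S := by
    intro X hX
    apply Matrix.diagonal_transvection_induction (fun X => X ∈ S) X
    · intro D hD
      exact hd1 D (hD.trans hX)
    · exact htr
    · intro A B hA hB
      exact S.mul_mem hA hB
  have hgl : ∀ X : Matrix (Fin (d + 1)) (Fin (d + 1)) 𝕂, X.det ≠ 0 → X ∈ S := by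
    intro X hX
    obtain ⟨h, hh, hdet'⟩ := hdet _ hX
    have hu : IsUnit h.det := by rw [hdet']; exact isUnit_iff_ne_zero.2 hX
    have : X = h * (h⁻¹ * X) := by
      rw [← mul_assoc, Matrix.mul_nonsing_inv _ hu, one_mul]
    rw [this]
    refine S.mul_mem hh (hsl _ ?_)
    rw [Matrix.det_mul, Matrix.det_nonsing_inv, hdet', Ring.inverse_eq_inv', inv_mul_cancel₀ hX]
  apply Matrix.diagonal_transvection_induction (fun X => X ∈ S) M
  · intro D _
    have hdense : Dense {D : Fin (d + 1) → 𝕂 | ∀ i, D i ≠ 0} := by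
      have := dense_pi (I := (univ : Set (Fin (d + 1)))) (s := fun _ => ({0}ᶜ : Set 𝕂))
        (fun _ _ => dense_compl_singleton 0)
      convert this using 1
      ext D
      simp [Set.mem_pi]
    have hc : IsClosed {D : Fin (d + 1) → 𝕂 | Matrix.diagonal D ∈ S} :=
      hS.preimage (continuous_id.matrix_diagonal)
    have hsub : {D : Fin (d + 1) → 𝕂 | ∀ i, D i ≠ 0} ⊆
        {D : Fin (d + 1) → 𝕂 | Matrix.diagonal D ∈ S} := by
      intro D hD
      refine hgl _ ?_
      rw [Matrix.det_diagonal]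
      exact Finset.prod_ne_zero_iff.2 fun i _ => hD i
    exact hc.closure_subset_iff.2 hsub (hdense D)
  · exact htr
  · intro A B hA hB
    exact S.mul_mem hA hB

lemma hdet_of {d : ℕ} (S : Submonoid (Matrix (Fin (d + 1)) (Fin (d + 1)) 𝕂)) (e : ℝ → 𝕂)
    (hadd : ∀ x y, e (x + y) = e x * e y) (h0 : e 0 = 1)
    (hsurj : ∀ z : 𝕂, z ≠ 0 →
      ∃ (x ψ : ℝ) (k : ℕ), z = (-1) ^ k * (((Real.exp x : ℝ) : 𝕂) * e ψ))
    (Z : Matrix (Fin (d + 1)) (Fin (d + 1)) 𝕂) (hZ : Z.det = -1)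
    (hmem : ∀ (x ψ : ℝ) (i : ℕ), (((Real.exp x : ℝ) : 𝕂) * e ψ) • (Z ^ i) ∈ S)
    (z : 𝕂) (hz : z ≠ 0) : ∃ h ∈ S, h.det = z := by
  obtain ⟨x, ψ, k, rfl⟩ := hsurj z hz
  have epow : ∀ (x : ℝ) (k : ℕ), e (k * x) = e x ^ k := by
    intro x k
    induction k with
    | zero => simp [h0]
    | succ k ih => rw [pow_succ, ← ih, ← hadd]; congr 1; push_cast; ring
  have hn : ((d + 1 : ℕ) : ℝ) ≠ 0 := by positivity
  refine ⟨_, hmem (x / (d + 1 : ℕ)) (ψ / (d + 1 : ℕ)) k, ?_⟩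
  rw [Matrix.det_smul, Matrix.det_pow, hZ, Fintype.card_fin, mul_pow, ← epow, ← RCLike.ofReal_pow,
    ← Real.exp_nat_mul, mul_div_cancel₀ _ hn, mul_div_cancel₀ _ hn]
  ring

/-- The weights. -/
noncomputable def wt {d : ℕ} (a : 𝕂) (i : Fin (d + 2)) : 𝕂 := (a⁻¹) ^ (i : ℕ)

/-- The weighted cyclic shift. -/
noncomputable def shift (d : ℕ) (a : 𝕂) : Matrix (Fin (d + 2)) (Fin (d + 2)) 𝕂 :=
  Matrix.diagonal (wt a) * ((finRotate (d + 2))⁻¹).permMatrix 𝕂 * Matrix.diagonal (wt a)⁻¹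

/-- The inverse of the weighted cyclic shift. -/
noncomputable def shiftInv (d : ℕ) (a : 𝕂) : Matrix (Fin (d + 2)) (Fin (d + 2)) 𝕂 :=
  Matrix.diagonal (wt a) * (finRotate (d + 2)).permMatrix 𝕂 * Matrix.diagonal (wt a)⁻¹

lemma wt_diag {d : ℕ} {a : 𝕂} (ha : a ≠ 0) :
    Matrix.diagonal (wt (d := d) a)⁻¹ * Matrix.diagonal (wt a) = 1 := by
  rw [Matrix.diagonal_mul_diagonal, ← Matrix.diagonal_one]
  congr 1
  ext i
  have : wt a i ≠ 0 := pow_ne_zero _ (inv_ne_zero ha)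
  simp [this]

lemma wt_diag' {d : ℕ} {a : 𝕂} (ha : a ≠ 0) :
    Matrix.diagonal (wt (d := d) a) * Matrix.diagonal (wt a)⁻¹ = 1 := by
  rw [Matrix.diagonal_mul_diagonal, ← Matrix.diagonal_one]
  congr 1
  ext i
  have : wt a i ≠ 0 := pow_ne_zero _ (inv_ne_zero ha)
  simp [this]

lemma conj_mul {m : ℕ} (D D' X Y : Matrix (Fin m) (Fin m) 𝕂) (h : D' * D = 1) :
    (D * X * D') * (D * Y * D') = D * (X * Y) * D' := by
  calc _ = D * X * (D' * D) * Y * D' := by simp only [mul_assoc]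
    _ = _ := by rw [h]; simp only [mul_assoc, mul_one, one_mul]

lemma shift_mul_inv (d : ℕ) {a : 𝕂} (ha : a ≠ 0) : shift d a * shiftInv d a = 1 := by
  unfold shift shiftInv
  rw [conj_mul _ _ _ _ (wt_diag ha), ← Matrix.permMatrix_mul, mul_inv_cancel,
    Matrix.permMatrix_one, mul_one, wt_diag' ha]

lemma shift_pow (d : ℕ) {a : 𝕂} (ha : a ≠ 0) (k : ℕ) : shift d a ^ k =
    Matrix.diagonal (wt a) * (((finRotate (d + 2))⁻¹) ^ k).permMatrix 𝕂 *
      Matrix.diagonal (wt a)⁻¹ := by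
  induction k with
  | zero => simp only [pow_zero, Matrix.permMatrix_one, mul_one, wt_diag' ha]
  | succ k ih =>
    rw [pow_succ, ih, shift, conj_mul _ _ _ _ (wt_diag ha), ← Matrix.permMatrix_mul, pow_succ']

lemma exists_shift_pow (d : ℕ) {a : 𝕂} (ha : a ≠ 0) : ∃ N, 1 ≤ N ∧ (-shift d a) ^ N = 1 := by
  refine ⟨2 * orderOf ((finRotate (d + 2))⁻¹), ?_, ?_⟩
  · have := orderOf_pos ((finRotate (d + 2))⁻¹)
    omega
  · rw [pow_mul, neg_sq, ← pow_mul, mul_comm, pow_mul, shift_pow d ha, pow_orderOf_eq_one,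
      Matrix.permMatrix_one, mul_one, wt_diag' ha, one_pow]

lemma det_neg_shift (d : ℕ) {a : 𝕂} (ha : a ≠ 0) : (-shift d a).det = -1 := by
  rw [Matrix.det_neg, shift, Matrix.det_mul_right_comm, wt_diag' ha, one_mul,
    Matrix.det_permutation, Equiv.Perm.sign_inv, sign_finRotate, Fintype.card_fin]
  simp only [Nat.add_one_sub_one, show d + 2 - 1 = d + 1 by omega]
  push_cast
  rw [← pow_add, show d + 2 + (d + 1) = 2 * (d + 1) + 1 by ring, pow_succ, pow_mul]
  simp

lemma shift_apply (d : ℕ) (a : 𝕂) (i j : Fin (d + 2)) :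
    shift d a i j = if i = j + 1 then wt a i * (wt a j)⁻¹ else 0 := by
  rw [shift, Matrix.mul_diagonal, Matrix.diagonal_mul, Equiv.Perm.permMatrix,
    PEquiv.toMatrix_apply]
  simp [Equiv.toPEquiv_apply, Equiv.Perm.inv_def, sub_eq_iff_eq_add]

lemma conj_shift {d : ℕ} {a : 𝕂} (ha : a ≠ 0)
    (S : Submonoid (Matrix (Fin (d + 2)) (Fin (d + 2)) 𝕂))
    (h1 : -shift d a ∈ S) (h2 : -shiftInv d a ∈ S) (p q : Fin (d + 2))
    (X X' : Matrix (Fin 2) (Fin 2) 𝕂) (hX : emb p q X ∈ S)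
    (hXX : !![-(wt a (p + 1) * (wt a p)⁻¹), 0; 0, -(wt a (q + 1) * (wt a q)⁻¹)] * X =
      X' * !![-(wt a (p + 1) * (wt a p)⁻¹), 0; 0, -(wt a (q + 1) * (wt a q)⁻¹)]) :
    emb (p + 1) (q + 1) X' ∈ S := by
  have := S.mul_mem (S.mul_mem h1 hX) h2
  rwa [conj_emb (r := p + 1) (s := q + 1) _ _ _ hXX] at this
  · rw [neg_mul_neg, shift_mul_inv d ha]
  · ext x c
    rw [Matrix.mul_apply, Matrix.mul_apply]
    fin_cases c <;> simp [incl, shift_apply] <;> grind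
  · ext c x
    rw [Matrix.mul_apply, Matrix.mul_apply]
    fin_cases c <;> simp [incl, shift_apply] <;> grind

lemma exists_dense_succ_succ (𝕂 : Type*) [RCLike 𝕂] (d : ℕ) :
    ∃ A B : Matrix (Fin (d + 2)) (Fin (d + 2)) 𝕂,
      Dense ((Subsemigroup.closure {A, B} : Subsemigroup (Matrix (Fin (d + 2)) (Fin (d + 2)) 𝕂)) :
        Set (Matrix (Fin (d + 2)) (Fin (d + 2)) 𝕂)) := by
  obtain ⟨e, hec, hadd, h0, hper, hspan, hsurj⟩ := exists_phase 𝕂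
  have epow : ∀ (x : ℝ) (k : ℕ), e x ^ k = e (k * x) := by
    intro x k
    induction k with
    | zero => simp [h0]
    | succ k ih => rw [pow_succ, ih, ← hadd]; congr 1; push_cast; ring
  have hne : ∀ x, e x ≠ 0 := by
    intro x hx
    have := hadd x (-x)
    rw [hx, add_neg_cancel, h0, zero_mul] at this
    exact one_ne_zero this
  let a : 𝕂 := 2 * e (π / (4 * (d + 2)))
  have ha : a ≠ 0 := mul_ne_zero two_ne_zero (hne _)
  let b : 𝕂 := a ^ (d + 2)
  have hb : b = 2 ^ (d + 2) * e (π / 4) := by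
    simp only [b, a, mul_pow, epow]
    congr 2
    push_cast
    field_simp
  have hb2 : b ^ 2 = ((((2 : ℝ) ^ (d + 2)) ^ 2 : ℝ) : 𝕂) * e (π / 2) := by
    rw [hb, mul_pow, epow]
    push_cast
    congr 2
    ring
  have hb8 : b ^ 8 = ((((2 : ℝ) ^ (d + 2)) ^ 8 : ℝ) : 𝕂) := by
    rw [hb, mul_pow, epow]
    push_cast
    rw [show (8 : ℝ) * (π / 4) = 2 * π by ring, hper, mul_one]
  have hspan' : ∀ x : 𝕂, ∃ r s : ℝ, x = (r : 𝕂) + (s : 𝕂) * b ^ 2 := by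
    intro x
    obtain ⟨r, s, h⟩ := hspan x
    refine ⟨r, s / ((2 : ℝ) ^ (d + 2)) ^ 2, ?_⟩
    rw [hb2, ← mul_assoc, ← RCLike.ofReal_mul, div_mul_cancel₀ _ (by positivity), h]
  have h01 : (0 : Fin (d + 2)) ≠ 1 := by simp
  obtain ⟨N, hN, hZN⟩ := exists_shift_pow d ha
  obtain ⟨A, B, S, hS, hSsub, hmem⟩ := core e hec hadd h0 hper N hN (-shift d a) hZN
    (fun φ => emb 0 1 (rot 𝕂 φ)) ((emb_continuous 0 1).comp rot_continuous)
    (fun x y => by simp only [rot_add, emb_mul h01]) (by simp only [rot_zero, emb_one])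
    (by simp only [rot_two_pi, emb_one])
  refine ⟨A, B, fun M => hSsub ?_⟩
  have hZi : ∀ i, (-shift d a) ^ i ∈ S := fun i => by
    simpa [h0, rot_zero, emb_one] using hmem 0 0 0 i
  have hR : ∀ φ, emb 0 1 (rot 𝕂 φ) ∈ S := fun φ => by
    simpa [h0] using hmem 0 φ 0 0
  have hT : -shift d a ∈ S := by simpa using hZi 1
  have hT' : -shiftInv d a ∈ S := by
    have h1 : (-shift d a) ^ (N - 1) * (-shift d a) = 1 := by
      rw [← pow_succ, Nat.sub_add_cancel hN, hZN]
    have h2 : (-shift d a) * (-shiftInv d a) = 1 := by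
      rw [neg_mul_neg, shift_mul_inv d ha]
    rw [← left_inv_eq_right_inv h1 h2]
    exact hZi _
  have hwt : ∀ (p q : Fin (d + 2)), (q : ℕ) = p + 1 → wt a q * (wt a p)⁻¹ = a⁻¹ := by
    intro p q h
    simp only [wt, h, pow_succ]
    field_simp
  -- rotations in adjacent planes
  have hadj : ∀ (i : ℕ) (hi : i + 1 < d + 2),
      ∀ φ, emb (⟨i, by omega⟩ : Fin (d + 2)) ⟨i + 1, hi⟩ (rot 𝕂 φ) ∈ S := by
    intro i
    induction i with
    | zero => intro hi φ; exact hR φ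
    | succ i ih =>
      intro hi φ
      have e1 : (⟨i, by omega⟩ : Fin (d + 2)) + 1 = ⟨i + 1, by omega⟩ := by
        ext; rw [Fin.val_add_one_of_lt' (by simpa using by omega)]
      have e2 : (⟨i + 1, by omega⟩ : Fin (d + 2)) + 1 = ⟨i + 1 + 1, by omega⟩ := by
        ext; rw [Fin.val_add_one_of_lt' (by simpa using by omega)]
      have := conj_shift ha S hT hT' ⟨i, by omega⟩ ⟨i + 1, by omega⟩ (rot 𝕂 φ) (rot 𝕂 φ)
        (ih (by omega) φ) (by
          rw [e1, e2, hwt _ _ rfl, hwt _ _ rfl]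
          unfold rot
          generalize ((Real.cos φ : ℝ) : 𝕂) = c
          generalize ((Real.sin φ : ℝ) : 𝕂) = s
          ext x y
          fin_cases x <;> fin_cases y <;> simp <;> ring)
      rwa [e1, e2] at this
  have hlast0 : Fin.last (d + 1) ≠ 0 := by simp [Fin.ext_iff]
  -- the wrapped plane
  have hwrap : ∀ φ : ℝ, emb (Fin.last (d + 1)) 0 !![((Real.cos φ : ℝ) : 𝕂),
      -(b⁻¹ * ((Real.sin φ : ℝ) : 𝕂)); b * ((Real.sin φ : ℝ) : 𝕂), ((Real.cos φ : ℝ) : 𝕂)] ∈ S := by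
    intro φ
    have e1 : (⟨d, by omega⟩ : Fin (d + 2)) + 1 = Fin.last (d + 1) := by
      ext; rw [Fin.val_add_one_of_lt' (by simp)]; simp
    have e2 : (⟨d + 1, by omega⟩ : Fin (d + 2)) + 1 = 0 := Fin.last_add_one (d + 1)
    have e3 : wt a (0 : Fin (d + 2)) * (wt a (⟨d + 1, by omega⟩ : Fin (d + 2)))⁻¹ =
        a ^ (d + 1) := by
      simp [wt]
    have := conj_shift ha S hT hT' ⟨d, by omega⟩ ⟨d + 1, by omega⟩ (rot 𝕂 φ)
      !![((Real.cos φ : ℝ) : 𝕂),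
      -(b⁻¹ * ((Real.sin φ : ℝ) : 𝕂)); b * ((Real.sin φ : ℝ) : 𝕂), ((Real.cos φ : ℝ) : 𝕂)]
      (hadj d (by omega) φ) (by
        rw [e1, e2, e3, hwt _ _ (by simp)]
        unfold rot
        generalize ((Real.cos φ : ℝ) : 𝕂) = c
        generalize ((Real.sin φ : ℝ) : 𝕂) = s
        ext x y
        fin_cases x <;> fin_cases y <;> simp [b, pow_succ] <;> field_simp)
    rwa [e1, e2] at this
  -- rotations in all planes
  have hrot0 : ∀ (i : ℕ) (hi : i + 1 < d + 2),
      ∀ φ, emb (0 : Fin (d + 2)) ⟨i + 1, hi⟩ (rot 𝕂 φ) ∈ S := by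
    intro i
    induction i with
    | zero => intro hi φ; exact hR φ
    | succ i ih =>
      intro hi φ
      exact move_emb S (j := ⟨i + 1, by omega⟩) (by simp [Fin.ext_iff]) (by simp [Fin.ext_iff])
        (by simp [Fin.ext_iff]) (hadj (i + 1) hi) (ih (by omega) φ)
  have hrot0' : ∀ j : Fin (d + 2), j ≠ 0 → ∀ φ, emb 0 j (rot 𝕂 φ) ∈ S := by
    rintro ⟨j, hj⟩ hj0
    obtain ⟨i, rfl⟩ : ∃ i, j = i + 1 :=
      Nat.exists_eq_succ_of_ne_zero fun h => hj0 (by ext; simpa using h)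
    exact hrot0 i hj
  have hrot : ∀ i j : Fin (d + 2), i ≠ j → ∀ φ, emb i j (rot 𝕂 φ) ∈ S := by
    intro i j hij
    by_cases hi : i = 0
    · subst hi; exact hrot0' j hij.symm
    by_cases hj : j = 0
    · subst hj; exact rot_symm S (hrot0' i hij)
    · intro φ
      exact move_emb S hi (Ne.symm hj) hij (hrot0' j hj) (rot_symm S (hrot0' i hi) φ)
  -- all unipotents
  let Q : Fin (d + 2) → Fin (d + 2) → Prop := fun i j =>
    (∀ x : 𝕂, emb i j !![1, x; 0, 1] ∈ S) ∧ (∀ x : 𝕂, emb i j !![1, 0; x, 1] ∈ S) ∧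
    (∀ y : 𝕂, y ≠ 0 → emb i j !![y, 0; 0, y⁻¹] ∈ S)
  have hQ0 : Q (Fin.last (d + 1)) 0 :=
    two_by_two (S.comap (embHom hlast0)) (hS.preimage (emb_continuous _ _)) b
      (((2 : ℝ) ^ (d + 2)) ^ 8) (one_lt_pow₀ (one_lt_pow₀ one_lt_two (by simp)) (by simp)) hb8 hspan'
      (fun φ => hrot _ _ hlast0 φ) hwrap
  have hQsymm : ∀ i j, Q i j → Q j i := by
    rintro i j ⟨h1, h2, h3⟩
    refine ⟨fun x => ?_, fun x => ?_, fun y hy => ?_⟩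
    · rw [emb_swap]; exact h2 x
    · rw [emb_swap]; exact h1 x
    · rw [emb_swap]
      have := h3 y⁻¹ (inv_ne_zero hy)
      rwa [inv_inv] at this
  have hQmove : ∀ i j k, i ≠ j → i ≠ k → Q i j → Q i k := by
    intro i j k hij hik h
    by_cases hjk : j = k
    · subst hjk; exact h
    obtain ⟨h1, h2, h3⟩ := h
    exact ⟨fun x => move_emb S hij hjk hik (hrot j k hjk) (h1 x),
      fun x => move_emb S hij hjk hik (hrot j k hjk) (h2 x),
      fun y hy => move_emb S hij hjk hik (hrot j k hjk) (h3 y hy)⟩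
  have hQ : ∀ i j, i ≠ j → Q i j := by
    intro i j hij
    by_cases hj : j = Fin.last (d + 1)
    · subst hj
      exact hQsymm _ _ (hQmove _ _ _ hlast0 hij.symm hQ0)
    · exact hQsymm _ _ (hQmove j _ i hj hij.symm
        (hQsymm _ _ (hQmove _ _ _ hlast0 (Ne.symm hj) hQ0)))
  exact eq_univ_of S hS (fun i j h => (hQ i j h).1) (fun i j h => (hQ i j h).2.2)
    (hdet_of S e hadd h0 hsurj _ (det_neg_shift d ha) (fun x ψ i => by
      simpa [rot_zero, emb_one] using hmem x 0 ψ i)) M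

lemma exists_dense_one (𝕂 : Type*) [RCLike 𝕂] :
    ∃ A B : Matrix (Fin (0 + 1)) (Fin (0 + 1)) 𝕂,
      Dense ((Subsemigroup.closure {A, B} : Subsemigroup (Matrix (Fin (0 + 1)) (Fin (0 + 1)) 𝕂)) :
        Set (Matrix (Fin (0 + 1)) (Fin (0 + 1)) 𝕂)) := by
  obtain ⟨e, hec, hadd, h0, hper, hspan, hsurj⟩ := exists_phase 𝕂
  obtain ⟨A, B, S, hS, hSsub, hmem⟩ := core (n := 0 + 1) e hec hadd h0 hper 2 (by norm_num) (-1)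
    (by simp) (fun _ => 1) continuous_const (by simp) rfl rfl
  refine ⟨A, B, fun M => hSsub ?_⟩
  refine eq_univ_of S hS (fun i j h => absurd (Fin.ext (by omega)) h)
    (fun i j h => absurd (Fin.ext (by omega)) h)
    (hdet_of S e hadd h0 hsurj (-1) (by simp) (fun x ψ i => by simpa using hmem x 0 ψ i)) M

end DenseSG

theorem exists_dense_two_generator_semigroup {𝕂 : Type*} [RCLike 𝕂] {n : ℕ} (hn : 1 ≤ n) :
    ∃ A B : Matrix (Fin n) (Fin n) 𝕂,
      Dense ((Subsemigroup.closure {A, B} : Subsemigroup (Matrix (Fin n) (Fin n) 𝕂)) :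
        Set (Matrix (Fin n) (Fin n) 𝕂)) := by
  match n, hn with
  | 1, _ => exact DenseSG.exists_dense_one 𝕂
  | d + 2, _ => exact DenseSG.exists_dense_succ_succ 𝕂 d
end
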